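/- arXiv:1307.3535 — 2 statements merged into one kernel-verified Lean document; each statement's English description precedes it below -/
import Mathlib

section
/- Let g = (a b; c d) ∈ SL₂(ℝ) and let ι(g) be the 3×3 real matrix ι(g) = ( (a²−b²−c²+d²)/2, cd−ab, (−a²−b²+c²+d²)/2 ; bd−ac, bc+ad, ac+bd ; (−a²+b²−c²+d²)/2, ab+cd, (a²+b²+c²+d²)/2 ). Then ι(g)ᵀ · J · ι(g) = J, where J = diag(1, 1, −1), and the row vector (1, 0, 1) · ι(g) equals (d² − c², 2cd, c² + d²); in particular, the image point lies on the cone x² + y² − z² = 0 and its third coordinate (the hypotenuse) is c² + d². -/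
open Matrix

noncomputable section

/-- `SL₂(ℝ)`. -/
abbrev SL2R := Matrix.SpecialLinearGroup (Fin 2) ℝ

/-- The spin cover `ι : SL₂(ℝ) → SO°(2,1)`, given explicitly on
`g = (a b; c d)`. -/
def iota (g : SL2R) : Matrix (Fin 3) (Fin 3) ℝ :=
  !![(g 0 0 ^ 2 - g 0 1 ^ 2 - g 1 0 ^ 2 + g 1 1 ^ 2) / 2,
       g 1 0 * g 1 1 - g 0 0 * g 0 1,
       (-g 0 0 ^ 2 - g 0 1 ^ 2 + g 1 0 ^ 2 + g 1 1 ^ 2) / 2;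
     g 0 1 * g 1 1 - g 0 0 * g 1 0,
       g 0 1 * g 1 0 + g 0 0 * g 1 1,
       g 0 0 * g 1 0 + g 0 1 * g 1 1;
     (-g 0 0 ^ 2 + g 0 1 ^ 2 - g 1 0 ^ 2 + g 1 1 ^ 2) / 2,
       g 0 0 * g 0 1 + g 1 0 * g 1 1,
       (g 0 0 ^ 2 + g 0 1 ^ 2 + g 1 0 ^ 2 + g 1 1 ^ 2) / 2]

/-- The Gram matrix `J = diag(1,1,−1)` of the form `x² + y² − z²`. -/
def Jmat : Matrix (Fin 3) (Fin 3) ℝ := !![1, 0, 0; 0, 1, 0; 0, 0, -1]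

/-- `ι(g)ᵀ J ι(g) = J`, the row vector `(1,0,1)·ι(g)` equals
`(d² − c², 2cd, c² + d²)`, the image point lies on the cone `x² + y² − z² = 0`,
and its third coordinate is `c² + d²`. -/
theorem iota_preserves_form_and_hypotenuse (g : SL2R) :
    (iota g)ᵀ * Jmat * iota g = Jmat ∧
      Matrix.vecMul ![1, 0, 1] (iota g) =
        ![g 1 1 ^ 2 - g 1 0 ^ 2, 2 * g 1 0 * g 1 1, g 1 0 ^ 2 + g 1 1 ^ 2] ∧
      (g 1 1 ^ 2 - g 1 0 ^ 2) ^ 2 + (2 * g 1 0 * g 1 1) ^ 2 -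
          (g 1 0 ^ 2 + g 1 1 ^ 2) ^ 2 = 0 ∧
      Matrix.vecMul ![1, 0, 1] (iota g) 2 = g 1 0 ^ 2 + g 1 1 ^ 2 := by
  have h : g 0 0 * g 1 1 - g 0 1 * g 1 0 = 1 := by
    have := g.det_coe
    rwa [Matrix.det_fin_two] at this
  have h2 : (g 0 0 * g 1 1 - g 0 1 * g 1 0) ^ 2 = 1 := by rw [h]; norm_num
  refine ⟨?_, ?_, by ring, ?_⟩
  · ext i j
    fin_cases i <;> fin_cases j <;>
      simp [iota, Jmat, Matrix.mul_apply, Fin.sum_univ_three] <;>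
      first
        | ring1
        | linear_combination h2
        | linear_combination -h2
  · ext i
    fin_cases i <;>
      simp [iota, Matrix.vecMul, dotProduct, Fin.sum_univ_three] <;> ring
  · simp [iota, Matrix.vecMul, dotProduct, Fin.sum_univ_three]
    ring
end
end

section
/- There exists an absolute constant κ > 0 with the following property. Let Y ≥ 2 be real, let q be an integer with q ≥ Y^κ, let u, v ∈ ℤ with gcd(u, q) = 1, and let ū denote an inverse of u modulo q. Let T be a finite set of matrices ω = (a b; c d) ∈ SL₂(ℤ) each satisfying a² + b² + c² + d² < Y², and suppose that for every ω ∈ T one has (a² + b²) + 2 ū v (a c + b d) + (ū v)² (c² + d²) ≡ 0 (mod q). Then there exist integers t*, u*, v*, not all zero, such that t*(a² + b²) + u*(a c + b d) + v*(c² + d²) = 0 for every ω = (a b; c d) ∈ T. -/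
noncomputable section

/-- `SL₂(ℤ)`. -/
abbrev SL2Z := Matrix.SpecialLinearGroup (Fin 2) ℤ



lemma minor_bound (N a b c d : ℝ) (ha : |a| ≤ N) (hb : |b| ≤ N) (hc : |c| ≤ N) (hd : |d| ≤ N) :
    |a * b - c * d| ≤ 2 * N ^ 2 := by
  have hN : 0 ≤ N := (abs_nonneg a).trans ha
  have h1 : |a * b| ≤ N * N := by
    rw [abs_mul]; exact mul_le_mul ha hb (abs_nonneg _) hN
  have h2 : |c * d| ≤ N * N := by
    rw [abs_mul]; exact mul_le_mul hc hd (abs_nonneg _) hN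
  have h3 := abs_sub (a * b) (c * d)
  nlinarith

lemma det_zero (Y : ℝ) (hY : 2 ≤ Y) (q : ℕ) (hq : Y ^ (9 : ℕ) ≤ (q : ℝ)) (x : ℤ)
    (A1 B1 C1 A2 B2 C2 A3 B3 C3 : ℤ)
    (hA1 : |(A1 : ℝ)| < Y ^ 2) (hB1 : |(B1 : ℝ)| ≤ Y ^ 2) (hC1 : |(C1 : ℝ)| ≤ Y ^ 2)
    (hA2 : |(A2 : ℝ)| ≤ Y ^ 2) (hB2 : |(B2 : ℝ)| ≤ Y ^ 2) (hC2 : |(C2 : ℝ)| ≤ Y ^ 2)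
    (hA3 : |(A3 : ℝ)| ≤ Y ^ 2) (hB3 : |(B3 : ℝ)| ≤ Y ^ 2) (hC3 : |(C3 : ℝ)| ≤ Y ^ 2)
    (h1 : (q : ℤ) ∣ A1 + 2 * x * B1 + x ^ 2 * C1)
    (h2 : (q : ℤ) ∣ A2 + 2 * x * B2 + x ^ 2 * C2)
    (h3 : (q : ℤ) ∣ A3 + 2 * x * B3 + x ^ 2 * C3) :
    (B1 * C2 - B2 * C1) * A3 + (C1 * A2 - C2 * A1) * B3 + (A1 * B2 - A2 * B1) * C3 = 0 := by
  apply Int.eq_zero_of_abs_lt_dvd (m := (q : ℤ))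
  · have : (B1 * C2 - B2 * C1) * A3 + (C1 * A2 - C2 * A1) * B3 + (A1 * B2 - A2 * B1) * C3
        = (A1 + 2 * x * B1 + x ^ 2 * C1) * (B2 * C3 - B3 * C2)
          + (A2 + 2 * x * B2 + x ^ 2 * C2) * (B3 * C1 - B1 * C3)
          + (A3 + 2 * x * B3 + x ^ 2 * C3) * (B1 * C2 - B2 * C1) := by ring
    rw [this]
    exact dvd_add (dvd_add (h1.mul_right _) (h2.mul_right _)) (h3.mul_right _)
  · have e1 := minor_bound _ _ _ _ _ hB1 hC2 hB2 hC1
    have e2 := minor_bound _ _ _ _ _ hC1 hA2 hC2 hA1.le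
    have e3 := minor_bound _ _ _ _ _ hA1.le hB2 hA2 hB1
    have key : ∀ m a : ℝ, |m| ≤ 2 * (Y ^ 2) ^ 2 → |a| ≤ Y ^ 2 → |m * a| ≤ 2 * Y ^ 6 := by
      intro m a hm ha
      rw [abs_mul]
      calc |m| * |a| ≤ (2 * (Y ^ 2) ^ 2) * Y ^ 2 :=
            mul_le_mul hm ha (abs_nonneg _) (by positivity)
        _ = 2 * Y ^ 6 := by ring
    have f1 := key _ _ e1 hA3
    have f2 := key _ _ e2 hB3
    have f3 := key _ _ e3 hC3
    have g : (8 : ℝ) * Y ^ 6 ≤ q := by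
      refine le_trans ?_ hq
      have : (2 : ℝ) ^ 3 ≤ Y ^ 3 := by gcongr
      calc (8 : ℝ) * Y ^ 6 = 2 ^ 3 * Y ^ 6 := by norm_num
        _ ≤ Y ^ 3 * Y ^ 6 := by gcongr
        _ = Y ^ 9 := by ring
    have hp : 0 < Y ^ 6 := by positivity
    have hR : |(((B1 * C2 - B2 * C1) * A3 + (C1 * A2 - C2 * A1) * B3
        + (A1 * B2 - A2 * B1) * C3 : ℤ) : ℝ)| < q := by
      push_cast
      have := abs_add_three (((B1 : ℝ) * C2 - B2 * C1) * A3) ((C1 * A2 - C2 * A1) * B3)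
        ((A1 * B2 - A2 * B1) * C3)
      linarith
    exact_mod_cast hR

lemma entry_bounds (Y : ℝ) (a b c d : ℤ)
    (h : ((a ^ 2 + b ^ 2 + c ^ 2 + d ^ 2 : ℤ) : ℝ) < Y ^ 2) :
    |((a ^ 2 + b ^ 2 : ℤ) : ℝ)| < Y ^ 2 ∧ |((a * c + b * d : ℤ) : ℝ)| < Y ^ 2 ∧
      |((c ^ 2 + d ^ 2 : ℤ) : ℝ)| < Y ^ 2 := by
  push_cast at *
  refine ⟨?_, ?_, ?_⟩ <;> rw [abs_lt] <;> constructor <;>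
    nlinarith [sq_nonneg (a : ℝ), sq_nonneg (b : ℝ), sq_nonneg (c : ℝ), sq_nonneg (d : ℝ),
      sq_nonneg (a + c : ℝ), sq_nonneg (a - c : ℝ), sq_nonneg (b + d : ℝ), sq_nonneg (b - d : ℝ)]

/-- there is an absolute `κ > 0` such that for `Y ≥ 2`, any
integer `q ≥ Y^κ`, any `u, v ∈ ℤ` with `gcd(u,q) = 1` and `ū` an inverse of `u`
mod `q`: if every `ω = (a b; c d)` in a finite set `T ⊆ SL₂(ℤ)` satisfies
`a² + b² + c² + d² < Y²` and
`(a² + b²) + 2 ū v (ac + bd) + (ū v)² (c² + d²) ≡ 0 (mod q)`, then there exist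
integers `t*, u*, v*`, not all zero, with
`t*(a² + b²) + u*(ac + bd) + v*(c² + d²) = 0` for all `ω ∈ T`. -/
theorem nullstellensatz_lift :
    ∃ κ : ℝ, 0 < κ ∧
      ∀ (Y : ℝ), 2 ≤ Y → ∀ (q : ℕ), Y ^ κ ≤ (q : ℝ) →
        ∀ (u v ub : ℤ), Int.gcd u (q : ℤ) = 1 → u * ub ≡ 1 [ZMOD (q : ℤ)] →
          ∀ (T : Finset SL2Z),
            (∀ ω ∈ T,
              ((ω 0 0 ^ 2 + ω 0 1 ^ 2 + ω 1 0 ^ 2 + ω 1 1 ^ 2 : ℤ) : ℝ) < Y ^ 2) →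
            (∀ ω ∈ T, (q : ℤ) ∣
              ((ω 0 0 ^ 2 + ω 0 1 ^ 2) +
                2 * (ub * v) * (ω 0 0 * ω 1 0 + ω 0 1 * ω 1 1) +
                (ub * v) ^ 2 * (ω 1 0 ^ 2 + ω 1 1 ^ 2))) →
            ∃ ts us vs : ℤ, ¬(ts = 0 ∧ us = 0 ∧ vs = 0) ∧
              ∀ ω ∈ T,
                ts * (ω 0 0 ^ 2 + ω 0 1 ^ 2) +
                  us * (ω 0 0 * ω 1 0 + ω 0 1 * ω 1 1) +
                  vs * (ω 1 0 ^ 2 + ω 1 1 ^ 2) = 0 := by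
  refine ⟨9, by norm_num, ?_⟩
  intro Y hY q hq u v ub _ _ T hT hdvd
  have hq' : Y ^ (9 : ℕ) ≤ (q : ℝ) := by
    rw [← Real.rpow_natCast]; exact_mod_cast hq
  by_cases hA : ∀ ω ∈ T, ω 0 0 ^ 2 + ω 0 1 ^ 2 = 0
  · refine ⟨1, 0, 0, by simp, fun ω hω => ?_⟩
    rw [hA ω hω]; ring
  push Not at hA
  obtain ⟨ω₁, hω₁, hA1⟩ := hA
  obtain ⟨a1, b1, c1⟩ := entry_bounds Y _ _ _ _ (hT ω₁ hω₁)
  have d1 := hdvd ω₁ hω₁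
  generalize ω₁ 0 0 ^ 2 + ω₁ 0 1 ^ 2 = A1 at *
  generalize ω₁ 0 0 * ω₁ 1 0 + ω₁ 0 1 * ω₁ 1 1 = B1 at *
  generalize ω₁ 1 0 ^ 2 + ω₁ 1 1 ^ 2 = C1 at *
  by_cases hc : ∀ ω ∈ T, A1 * (ω 0 0 * ω 1 0 + ω 0 1 * ω 1 1) - (ω 0 0 ^ 2 + ω 0 1 ^ 2) * B1 = 0
  · refine ⟨B1, -A1, 0, by simp [hA1], fun ω hω => ?_⟩
    linear_combination -hc ω hω
  push Not at hc
  obtain ⟨ω₂, hω₂, hn⟩ := hc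
  obtain ⟨a2, b2, c2⟩ := entry_bounds Y _ _ _ _ (hT ω₂ hω₂)
  have d2 := hdvd ω₂ hω₂
  generalize ω₂ 0 0 ^ 2 + ω₂ 0 1 ^ 2 = A2 at *
  generalize ω₂ 0 0 * ω₂ 1 0 + ω₂ 0 1 * ω₂ 1 1 = B2 at *
  generalize ω₂ 1 0 ^ 2 + ω₂ 1 1 ^ 2 = C2 at *
  refine ⟨B1 * C2 - B2 * C1, C1 * A2 - C2 * A1, A1 * B2 - A2 * B1,
    fun h => hn h.2.2, fun ω hω => ?_⟩
  · obtain ⟨a3, b3, c3⟩ := entry_bounds Y _ _ _ _ (hT ω hω)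
    exact det_zero Y hY q hq' (ub * v) _ _ _ _ _ _ _ _ _ a1 b1.le c1.le a2.le b2.le c2.le
      a3.le b3.le c3.le d1 d2 (hdvd ω hω)
end
end
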